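/- Let σ: S ↷ G be an algebraic action satisfying condition (M4): for every D ∈ 𝒞 there exist φ ∈ I^e and D' ∈ 𝒞 with D' ⊆ D ∩ dom(φ) and [G : φ(D')] < ∞ (this condition is equivalent to minimality of the tight groupoid 𝒢_σ). If some B ∈ 𝒞 satisfies [B : C] < ∞ for every C ∈ 𝒞 with C ⊆ B, then [G : D] < ∞ for every D ∈ 𝒞; in particular, σ satisfies the finite index property (FI): [G : σ_s(G)] < ∞ for all s ∈ S. -/

import Mathlib

open scoped Pointwise

/-- The family of `S`-constructible subgroups of `G`. -/
inductive IsConstructible {S G : Type*} [Monoid S] [Group G]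
    (σ : S →* Monoid.End G) : Subgroup G → Prop
  | top : IsConstructible σ ⊤
  | map : ∀ (s : S) (C : Subgroup G), IsConstructible σ C →
      IsConstructible σ (Subgroup.map (σ s) C)
  | comap : ∀ (s : S) (C : Subgroup G), IsConstructible σ C →
      IsConstructible σ (Subgroup.comap (σ s) C)

/- We model partial bijections of `G` by their graphs, i.e. subsets of `G × G`
that are graphs of injective partial functions; equality of graphs is exactly
equality of partial bijections. -/

/-- Graph of an everywhere-defined function. -/
def grph {G : Type*} (f : G → G) : Set (G × G) := {p | p.2 = f p.1}

/-- Composition `φ ∘ ψ` of partial bijections (apply `ψ` first), as graphs. -/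
def rcomp {G : Type*} (φ ψ : Set (G × G)) : Set (G × G) :=
  {p | ∃ y, (p.1, y) ∈ ψ ∧ (y, p.2) ∈ φ}

/-- Inverse of a partial bijection, as graphs. -/
def rinv {G : Type*} (φ : Set (G × G)) : Set (G × G) := {p | (p.2, p.1) ∈ φ}

/-- Domain of a partial bijection. -/
def rdom {G : Type*} (φ : Set (G × G)) : Set G := {x | ∃ y, (x, y) ∈ φ}

/-- The identity map on a subset `A ⊆ G`, as a graph. -/
def idOn {G : Type*} (A : Set G) : Set (G × G) := {p | p.1 = p.2 ∧ p.1 ∈ A}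

/-- Membership in the inverse semigroup of partial bijections generated by a
set of generators: closure under composition and inversion. -/
inductive MemInvSemigroup {G : Type*} (gens : Set (Set (G × G))) : Set (G × G) → Prop
  | base : ∀ φ ∈ gens, MemInvSemigroup gens φ
  | comp : ∀ φ ψ, MemInvSemigroup gens φ → MemInvSemigroup gens ψ →
      MemInvSemigroup gens (rcomp φ ψ)
  | inv : ∀ φ, MemInvSemigroup gens φ → MemInvSemigroup gens (rinv φ)

/-- The inverse semigroup `I` generated by the endomorphisms `σ_s` and the left
translations `t_g`. -/
def memI {S G : Type*} [Monoid S] [Group G] (σ : S →* Monoid.End G) :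
    Set (G × G) → Prop :=
  MemInvSemigroup ({φ | ∃ s : S, φ = grph (σ s : G → G)} ∪
    {φ | ∃ g : G, φ = grph (fun h : G => g * h)})


/-- The inverse semigroup `I^e` generated by the endomorphisms `σ_s` alone. -/
def memIe {S G : Type*} [Monoid S] [Group G] (σ : S →* Monoid.End G) :
    Set (G × G) → Prop :=
  MemInvSemigroup {φ | ∃ s : S, φ = grph (σ s : G → G)}

/-- Image of a set under a partial bijection (given as a graph). -/
def rimg {G : Type*} (φ : Set (G × G)) (E : Set G) : Set G := {y | ∃ x ∈ E, (x, y) ∈ φ}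

section Constructible

variable {S G : Type*} [Monoid S] [Group G] {σ : S →* Monoid.End G}

theorem IsConstructible.inf (hinj : ∀ s : S, Function.Injective (σ s)) {C D : Subgroup G}
    (hC : IsConstructible σ C) (hD : IsConstructible σ D) : IsConstructible σ (C ⊓ D) := by
  induction hC generalizing D with
  | top => simpa using hD
  | map s C _ ih =>
    have h : Subgroup.map (σ s) C ⊓ D = Subgroup.map (σ s) (C ⊓ Subgroup.comap (σ s) D) := by
      ext x
      constructor
      · rintro ⟨⟨y, hy, rfl⟩, hx⟩
        exact ⟨y, ⟨hy, hx⟩, rfl⟩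
      · rintro ⟨y, ⟨hy, hx⟩, rfl⟩
        exact ⟨⟨y, hy, rfl⟩, hx⟩
    rw [h]
    exact .map s _ (ih (.comap s D hD))
  | comap s C _ ih =>
    have h : Subgroup.comap (σ s) C ⊓ D = Subgroup.comap (σ s) (C ⊓ Subgroup.map (σ s) D) := by
      ext x
      exact and_congr_right fun _ => (Subgroup.mem_map_iff_mem (hinj s)).symm
    rw [h]
    exact .comap s _ (ih (.map s D hD))

/-- The image of a constructible subgroup under an element of `I^e`, or under its inverse, is
constructible. -/
theorem memIe.exists_isConstructible_rimg {φ : Set (G × G)} (hφ : memIe σ φ) :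
    (∀ C, IsConstructible σ C → ∃ D, IsConstructible σ D ∧ (D : Set G) = rimg φ C) ∧
      ∀ C, IsConstructible σ C → ∃ D, IsConstructible σ D ∧ (D : Set G) = rimg (rinv φ) C := by
  induction hφ with
  | base φ h =>
    obtain ⟨s, rfl⟩ := h
    refine ⟨fun C hC => ⟨_, .map s C hC, ?_⟩, fun C hC => ⟨_, .comap s C hC, ?_⟩⟩
    · ext x
      exact exists_congr fun y => and_congr_right fun _ => eq_comm
    · ext x
      refine ⟨fun hx => ⟨_, hx, rfl⟩, ?_⟩
      rintro ⟨y, hy, hyx⟩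
      have hyx : y = σ s x := hyx
      rw [hyx] at hy
      exact hy
  | comp φ ψ _ _ ihφ ihψ =>
    constructor
    · intro C hC
      obtain ⟨D, hD, hDC⟩ := ihψ.1 C hC
      obtain ⟨E, hE, hED⟩ := ihφ.1 D hD
      refine ⟨E, hE, ?_⟩
      rw [hED, hDC]
      ext x
      simp only [rimg, rcomp, Set.mem_ofPred_eq]
      tauto
    · intro C hC
      obtain ⟨D, hD, hDC⟩ := ihφ.2 C hC
      obtain ⟨E, hE, hED⟩ := ihψ.2 D hD
      refine ⟨E, hE, ?_⟩
      rw [hED, hDC]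
      ext x
      simp only [rimg, rcomp, rinv, Set.mem_ofPred_eq]
      tauto
  | inv φ _ ih => exact ⟨ih.2, ih.1⟩

/-- Elements of `I^e` are isomorphisms between subgroups of `G`: their graphs are subgroups of
`G × G` on which both projections are injective. -/
theorem memIe.exists_subgroup (hinj : ∀ s : S, Function.Injective (σ s))
    {φ : Set (G × G)} (hφ : memIe σ φ) :
    ∃ Γ : Subgroup (G × G), (Γ : Set (G × G)) = φ ∧
      (∀ x y z, (x, y) ∈ φ → (x, z) ∈ φ → y = z) ∧
      ∀ x y z, (x, z) ∈ φ → (y, z) ∈ φ → x = y := by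
  induction hφ with
  | base φ h =>
    obtain ⟨s, rfl⟩ := h
    refine ⟨MonoidHom.graph (σ s : G →* G), ?_, ?_, ?_⟩
    · ext x
      exact eq_comm
    · intro x y z hy hz
      exact hy.trans hz.symm
    · intro x y z hx hy
      exact hinj s (hx.symm.trans hy)
  | comp φ ψ _ _ ihφ ihψ =>
    obtain ⟨Γ, rfl, hΓ, hΓ'⟩ := ihφ
    obtain ⟨Δ, rfl, hΔ, hΔ'⟩ := ihψ
    refine ⟨{ carrier := rcomp Γ Δ, mul_mem' := ?_, one_mem' := ?_, inv_mem' := ?_ }, rfl, ?_, ?_⟩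
    · rintro _ _ ⟨y, hy, hy'⟩ ⟨z, hz, hz'⟩
      exact ⟨y * z, Δ.mul_mem hy hz, Γ.mul_mem hy' hz'⟩
    · exact ⟨1, Δ.one_mem, Γ.one_mem⟩
    · rintro _ ⟨y, hy, hy'⟩
      exact ⟨y⁻¹, Δ.inv_mem hy, Γ.inv_mem hy'⟩
    · rintro x y z ⟨u, hu, hu'⟩ ⟨v, hv, hv'⟩
      obtain rfl := hΔ _ _ _ hu hv
      exact hΓ _ _ _ hu' hv'
    · rintro x y z ⟨u, hu, hu'⟩ ⟨v, hv, hv'⟩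
      obtain rfl := hΓ' _ _ _ hu' hv'
      exact hΔ' _ _ _ hu hv
  | inv φ _ ih =>
    obtain ⟨Γ, rfl, hΓ, hΓ'⟩ := ih
    exact ⟨Γ.comap (MulEquiv.prodComm : G × G ≃* G × G).toMonoidHom, rfl,
      fun x y z h h' => hΓ' _ _ _ h h', fun x y z h h' => hΓ _ _ _ h h'⟩

end Constructible

/-- If the preimage `X` of `D` under a single-valued subgroup relation `Γ` has finite relative
index in `A`, then `D` has finite relative index in the image of `A`. -/
theorem Subgroup.relIndex_rimg_ne_zero {G : Type*} [Group G] {Γ : Subgroup (G × G)}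
    (hΓ : ∀ x y z, (x, y) ∈ Γ → (x, z) ∈ Γ → y = z) {A D E X : Subgroup G}
    (hE : (E : Set G) = rimg Γ A) (hX : (X : Set G) = rimg (rinv Γ) D)
    (h : X.relIndex A ≠ 0) : D.relIndex E ≠ 0 := by
  let f : Γ →* G := (MonoidHom.fst G G).comp Γ.subtype
  let g : Γ →* G := (MonoidHom.snd G G).comp Γ.subtype
  have hE' : E = (A.comap f).map g := by
    apply SetLike.coe_injective
    rw [hE]
    ext y
    constructor
    · rintro ⟨x, hx, hxy⟩
      exact ⟨⟨(x, y), hxy⟩, hx, rfl⟩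
    · rintro ⟨⟨⟨x, y⟩, hxy⟩, hx, rfl⟩
      exact ⟨x, hx, hxy⟩
  have hX' : D.comap g = X.comap f := by
    ext ⟨⟨x, y⟩, hxy⟩
    change y ∈ D ↔ x ∈ (X : Set G)
    rw [hX]
    constructor
    · exact fun hy => ⟨y, hy, hxy⟩
    · rintro ⟨z, hz, hxz⟩
      exact hΓ x y z hxy hxz ▸ hz
  rw [hE', ← Subgroup.relIndex_comap, hX', Subgroup.relIndex_comap]
  exact fun h0 => h (Subgroup.relIndex_eq_zero_of_le_right (Subgroup.map_comap_le f A) h0)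

/-- Lemma 4.21 (lem:PI): assume condition (M4) (equivalent to minimality of the
tight groupoid 𝒢_σ). If some `B ∈ 𝒞` satisfies `[B : C] < ∞` for every
constructible subgroup `C ⊆ B`, then every constructible subgroup has finite
index in `G`; in particular σ satisfies the finite index property (FI). -/
theorem finite_index_from_minimality {S G : Type*} [Monoid S] [Group G] [Nontrivial G]
    (σ : S →* Monoid.End G)
    (hinj : ∀ s : S, Function.Injective (σ s))
    (hfaith : Function.Injective σ)
    (hM4 : ∀ D : Subgroup G, IsConstructible σ D →
      ∃ (φ : Set (G × G)) (D' : Subgroup G), memIe σ φ ∧ IsConstructible σ D' ∧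
        (D' : Set G) ⊆ (D : Set G) ∩ rdom φ ∧
        ∃ B : Subgroup G, (B : Set G) = rimg φ (D' : Set G) ∧ B.index ≠ 0)
    (B : Subgroup G) (hB : IsConstructible σ B)
    (hBfin : ∀ C : Subgroup G, IsConstructible σ C → C ≤ B → C.relIndex B ≠ 0) :
    (∀ D : Subgroup G, IsConstructible σ D → D.index ≠ 0) ∧
    (∀ s : S, (MonoidHom.range (σ s : G →* G)).index ≠ 0) := by
  have key : ∀ D : Subgroup G, IsConstructible σ D → D.index ≠ 0 := by
    intro D hD
    obtain ⟨φ, D', hφ, -, hD'B, E, hE, hEfin⟩ := hM4 B hB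
    obtain ⟨X, hX, hXD⟩ := hφ.exists_isConstructible_rimg.2 D hD
    obtain ⟨Γ, rfl, hΓ, -⟩ := hφ.exists_subgroup hinj
    have hXB : X.relIndex B ≠ 0 := by
      rw [← Subgroup.inf_relIndex_right]
      exact hBfin _ (hX.inf hinj hB) inf_le_right
    have hle : D' ≤ B := fun x hx => (hD'B hx).1
    have hDE : D.relIndex E ≠ 0 := Subgroup.relIndex_rimg_ne_zero hΓ hE hXD
      fun h0 => hXB (Subgroup.relIndex_eq_zero_of_le_right hle h0)
    rw [← Subgroup.relIndex_top_right] at hEfin ⊢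
    exact Subgroup.relIndex_ne_zero_trans hDE hEfin
  refine ⟨key, fun s => ?_⟩
  exact MonoidHom.range_eq_map (σ s : G →* G) ▸ key _ (.map s ⊤ .top)
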